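/- Let (X_n)_{n≥1} be a sequence of random variables adapted to a filtration (H_n)_{n≥1}, and let β ≥ 0. If (1 + 1/n)^β E(|X_{n+1}| | H_n) ≤ |X_n| almost surely for all n ≥ 1, then the process Y_n := n^β |X_n| is a nonnegative supermartingale with respect to (H_n)_{n≥1}, and hence converges almost surely to some random variable Y_∞; if moreover n^β X_n → 0 in probability, then Y_∞ = 0 almost surely, i.e., n^β X_n → 0 almost surely. -/

import Mathlib

open MeasureTheory Filter

/-- A nonnegative supermartingale converges almost surely. -/
theorem MeasureTheory.Supermartingale.ae_exists_tendsto_of_nonneg {Ω : Type*}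
    {mΩ : MeasurableSpace Ω} {P : Measure Ω} [IsFiniteMeasure P] {ℱ : Filtration ℕ mΩ}
    {Y : ℕ → Ω → ℝ} (hY : Supermartingale Y ℱ P) (hnonneg : ∀ n, 0 ≤ᵐ[P] Y n) :
    ∀ᵐ ω ∂P, ∃ c, Tendsto (fun n => Y n ω) atTop (nhds c) := by
  have hbdd : ∀ n, eLpNorm ((-Y) n) 1 P ≤ (Real.toNNReal (∫ ω, Y 0 ω ∂P) : ENNReal) := by
    intro n
    rw [Pi.neg_apply, eLpNorm_neg, eLpNorm_one_eq_lintegral_enorm,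
      ← ofReal_integral_norm_eq_lintegral_enorm (hY.integrable n)]
    refine ENNReal.ofReal_le_ofReal ?_
    calc ∫ ω, ‖Y n ω‖ ∂P = ∫ ω, Y n ω ∂P :=
          integral_congr_ae ((hnonneg n).mono fun ω hω => Real.norm_of_nonneg hω)
      _ ≤ ∫ ω, Y 0 ω ∂P := by
          simpa using hY.setIntegral_le (Nat.zero_le n) MeasurableSet.univ
  filter_upwards [hY.neg.exists_ae_tendsto_of_bdd hbdd] with ω ⟨c, hc⟩
  exact ⟨-c, by simpa using hc.neg⟩

/-- A sequence that converges almost everywhere and in measure has the same limit in both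
senses. -/
theorem MeasureTheory.TendstoInMeasure.ae_eq_of_tendsto_ae {Ω E : Type*} [PseudoEMetricSpace E]
    [T2Space E] {mΩ : MeasurableSpace Ω} {μ : Measure Ω} {f : ℕ → Ω → E} {g h : Ω → E}
    (hg : TendstoInMeasure μ f atTop g)
    (hh : ∀ᵐ ω ∂μ, Tendsto (fun n => f n ω) atTop (nhds (h ω))) : g =ᵐ[μ] h := by
  obtain ⟨ns, hns, hlim⟩ := hg.exists_seq_tendsto_ae
  filter_upwards [hlim, hh] with ω hω hω'
  exact tendsto_nhds_unique hω (hω'.comp hns.tendsto_atTop)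

/-- If (X_n) is adapted to (H_n) and (1 + 1/n)^β E(|X_{n+1}| | H_n) ≤ |X_n| a.s. for all
n ≥ 1, then Y_n := n^β |X_n| is a nonnegative supermartingale, hence converges a.s. to some
Y_∞; if moreover n^β X_n → 0 in probability, then Y_∞ = 0 a.s., i.e. n^β X_n → 0 a.s. -/
theorem stmt_10 {Ω : Type} {mΩ : MeasurableSpace Ω} (P : Measure Ω) [IsProbabilityMeasure P]
    (β : ℝ) (hβ : 0 ≤ β) (ℱ : Filtration ℕ mΩ) (X : ℕ → Ω → ℝ)
    (hadapted : Adapted ℱ X) (hint : ∀ n, Integrable (X n) P)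
    -- (1 + 1/n)^β E(|X_{n+1}| | H_n) ≤ |X_n| a.s., for all n ≥ 1
    (hsuper : ∀ n : ℕ, 1 ≤ n → ∀ᵐ ω ∂P,
      (1 + 1 / (n : ℝ)) ^ β * (P[fun ω' => |X (n + 1) ω'| | ℱ n]) ω ≤ |X n ω|) :
    -- Y_n := n^β |X_n| is a nonnegative supermartingale
    (∀ n : ℕ, ∀ ω, 0 ≤ (n : ℝ) ^ β * |X n ω|) ∧
    (∀ n : ℕ, 1 ≤ n → ∀ᵐ ω ∂P,
      (P[fun ω' => ((n + 1 : ℕ) : ℝ) ^ β * |X (n + 1) ω'| | ℱ n]) ω ≤ (n : ℝ) ^ β * |X n ω|) ∧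
    -- hence it converges almost surely to some random variable Y_∞
    (∃ Ylim : Ω → ℝ, ∀ᵐ ω ∂P,
      Tendsto (fun n : ℕ => (n : ℝ) ^ β * |X n ω|) atTop (nhds (Ylim ω)) ∧
      -- if moreover n^β X_n → 0 in probability, then Y_∞ = 0 a.s.
      ((∀ ε : ℝ, 0 < ε →
          Tendsto (fun n : ℕ => P {ω' | ε < (n : ℝ) ^ β * |X n ω'|}) atTop (nhds 0)) →
        Ylim ω = 0)) ∧
    -- i.e., n^β X_n → 0 almost surely
    ((∀ ε : ℝ, 0 < ε →
        Tendsto (fun n : ℕ => P {ω' | ε < (n : ℝ) ^ β * |X n ω'|}) atTop (nhds 0)) →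
      ∀ᵐ ω ∂P, Tendsto (fun n : ℕ => (n : ℝ) ^ β * X n ω) atTop (nhds 0)) := by
  have hnonneg : ∀ n : ℕ, ∀ ω, 0 ≤ (n : ℝ) ^ β * |X n ω| := fun n ω => by positivity
  have hstep : ∀ n : ℕ, 1 ≤ n → ∀ᵐ ω ∂P,
      (P[fun ω' => ((n + 1 : ℕ) : ℝ) ^ β * |X (n + 1) ω'| | ℱ n]) ω ≤ (n : ℝ) ^ β * |X n ω| := by
    intro n hn
    have hn0 : (0 : ℝ) < n := by exact_mod_cast hn
    have hpow : ((n + 1 : ℕ) : ℝ) ^ β = (n : ℝ) ^ β * (1 + 1 / (n : ℝ)) ^ β := by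
      rw [← Real.mul_rpow hn0.le (by positivity)]
      congr 1
      push_cast
      field_simp
    filter_upwards [hsuper n hn,
      condExp_smul (μ := P) (((n + 1 : ℕ) : ℝ) ^ β) (fun ω' => |X (n + 1) ω'|) (ℱ n)]
      with ω hω hsmul
    calc (P[fun ω' => ((n + 1 : ℕ) : ℝ) ^ β * |X (n + 1) ω'| | ℱ n]) ω
        = ((n + 1 : ℕ) : ℝ) ^ β * (P[fun ω' => |X (n + 1) ω'| | ℱ n]) ω := hsmul
      _ = (n : ℝ) ^ β * ((1 + 1 / (n : ℝ)) ^ β * (P[fun ω' => |X (n + 1) ω'| | ℱ n]) ω) := by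
          rw [hpow, mul_assoc]
      _ ≤ (n : ℝ) ^ β * |X n ω| := by gcongr
  let 𝒢 : Filtration ℕ mΩ :=
    ⟨fun n => ℱ (n + 1), fun _ _ h => ℱ.mono (Nat.succ_le_succ h), fun n => ℱ.le (n + 1)⟩
  have hY : Supermartingale (fun n ω => ((n + 1 : ℕ) : ℝ) ^ β * |X (n + 1) ω|) 𝒢 P :=
    supermartingale_nat
      (fun n => ((hadapted (n + 1)).stronglyMeasurable.norm.const_mul _))
      (fun n => (hint (n + 1)).abs.const_mul _)
      (fun n => hstep (n + 1) n.succ_pos)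
  have hconv : ∀ᵐ ω ∂P, ∃ c, Tendsto (fun n : ℕ => (n : ℝ) ^ β * |X n ω|) atTop (nhds c) := by
    filter_upwards [hY.ae_exists_tendsto_of_nonneg fun n => ae_of_all _ (hnonneg (n + 1))]
      with ω ⟨c, hc⟩
    exact ⟨c, (tendsto_add_atTop_iff_nat 1).mp hc⟩
  obtain ⟨Ylim, hYlim⟩ := hconv.choice
  have hzero : (∀ ε : ℝ, 0 < ε →
      Tendsto (fun n : ℕ => P {ω' | ε < (n : ℝ) ^ β * |X n ω'|}) atTop (nhds 0)) →
      ∀ᵐ ω ∂P, Ylim ω = 0 := by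
    intro hprob
    have hmeas : TendstoInMeasure P (fun (n : ℕ) ω => (n : ℝ) ^ β * |X n ω|) atTop
        (fun _ => 0) := by
      rw [tendstoInMeasure_iff_norm]
      intro ε hε
      refine tendsto_of_tendsto_of_tendsto_of_le_of_le tendsto_const_nhds
        (hprob (ε / 2) (half_pos hε)) (fun _ => zero_le) fun n => measure_mono fun ω hω => ?_
      rw [Set.mem_ofPred_eq, sub_zero, Real.norm_of_nonneg (hnonneg n ω)] at hω
      exact (half_lt_self hε).trans_le hω
    exact (hmeas.ae_eq_of_tendsto_ae hYlim).symm
  refine ⟨hnonneg, hstep, ⟨Ylim, ?_⟩, fun hprob => ?_⟩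
  · filter_upwards [hYlim, eventually_imp_distrib_left.mpr hzero] with ω h₁ h₂
    exact ⟨h₁, h₂⟩
  · filter_upwards [hYlim, hzero hprob] with ω hω hω0
    rw [hω0] at hω
    refine squeeze_zero_norm (fun n => le_of_eq ?_) hω
    rw [norm_mul, Real.norm_eq_abs (X n ω), Real.norm_of_nonneg (by positivity)]
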